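/- Let d ≥ 2 be an integer, μ > 0, and set p₁ = (2/(d+2))·(d/μ)^(2/d). There exist constants C > 0 and z₀ > 0 such that for all z ≥ z₀, |P_FD(z) − p₁·z^(1+2/d)| ≤ C·z^(1−2/d); that is, P_FD(z) = p₁·z^(1+2/d) + O(z^(1−2/d)) as z → ∞. -/

import Mathlib

open Set MeasureTheory Function

/-- The Fermi function of order `α`. -/
noncomputable def fermi (α z : ℝ) : ℝ :=
  ∫ x in Set.Ioi (0:ℝ), x ^ α / (1 + Real.exp (x - z))

/-- The Fermi--Dirac pressure. -/
noncomputable def fermiDiracPressure (d : ℕ) (μ : ℝ) (z : ℝ) : ℝ :=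
  (μ / d) * fermi ((d : ℝ) / 2)
    (Function.invFun (fermi ((d : ℝ) / 2 - 1)) (2 * z / μ))

lemma fd_expint {s : ℝ} (hs : -1 < s) :
    IntegrableOn (fun x : ℝ => x ^ s * Real.exp (-x)) (Ioi 0) := by
  have h := Real.GammaIntegral_convergent (s := s + 1) (by linarith)
  refine h.congr_fun (fun x _ => ?_) measurableSet_Ioi
  simp [mul_comm]

lemma fd_le {x w β : ℝ} (hx : 0 < x) :
    x ^ β / (1 + Real.exp (x - w)) ≤ Real.exp w * (x ^ β * Real.exp (-x)) := by
  have h0 : 0 ≤ x ^ β := Real.rpow_nonneg hx.le _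
  rw [div_le_iff₀ (by positivity)]
  have : Real.exp w * (x ^ β * Real.exp (-x)) * (1 + Real.exp (x - w))
      = Real.exp w * (x ^ β * Real.exp (-x)) + x ^ β := by
    rw [Real.exp_sub, Real.exp_neg]; field_simp
  rw [this]
  have : 0 ≤ Real.exp w * (x ^ β * Real.exp (-x)) := by positivity
  linarith

lemma fd_meas (β w : ℝ) : Measurable (fun x : ℝ => x ^ β / (1 + Real.exp (x - w))) := by
  fun_prop

lemma fd_int {β : ℝ} (hβ : 0 ≤ β) (w : ℝ) :
    IntegrableOn (fun x : ℝ => x ^ β / (1 + Real.exp (x - w))) (Ioi 0) := by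
  refine Integrable.mono' ((fd_expint (s := β) (by linarith)).const_mul (Real.exp w))
    (fd_meas β w).aestronglyMeasurable ?_
  filter_upwards [ae_restrict_mem measurableSet_Ioi] with x hx
  have h0 : 0 ≤ x ^ β := Real.rpow_nonneg (le_of_lt hx) _
  rw [Real.norm_of_nonneg (by positivity)]
  exact fd_le hx

lemma fd_mono {β : ℝ} (hβ : 0 ≤ β) : Monotone (fermi β) := by
  intro w v hwv
  unfold fermi
  refine setIntegral_mono_on (fd_int hβ w) (fd_int hβ v) measurableSet_Ioi (fun x hx => ?_)
  have h0 : 0 ≤ x ^ β := Real.rpow_nonneg (le_of_lt hx) _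
  gcongr

lemma fd_cont {β : ℝ} (hβ : 0 ≤ β) : Continuous (fermi β) := by
  rw [continuous_iff_continuousAt]
  intro w
  unfold fermi
  refine continuousAt_of_dominated
    (bound := fun x => Real.exp (w + 1) * (x ^ β * Real.exp (-x))) ?_ ?_
    ((fd_expint (s := β) (by linarith)).const_mul _) ?_
  · exact Filter.Eventually.of_forall (fun v => (fd_meas β v).aestronglyMeasurable)
  · filter_upwards [eventually_lt_nhds (show w < w + 1 by linarith)] with v hv
    filter_upwards [ae_restrict_mem measurableSet_Ioi] with x hx
    have h0 : 0 ≤ x ^ β := Real.rpow_nonneg (le_of_lt hx) _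
    rw [Real.norm_of_nonneg (by positivity)]
    refine (fd_le hx).trans ?_
    gcongr
  · refine Filter.Eventually.of_forall (fun x => ?_)
    refine ContinuousAt.div (by fun_prop) (by fun_prop) (by positivity)

lemma fd_ptwise {β s : ℝ} (hβ : 0 ≤ β) (h0 : 0 ≤ s) (h1 : s ≤ 1) :
    |(1 + s) ^ β - (1 - s) ^ β| ≤ (2 ^ (β + 1) + β + 1) * s := by
  have hA : (1 + s) ^ β ≤ 1 + 2 ^ (β + 1) * s := by
    have h2 : (1 + s) ^ β ≤ (1 + s) ^ (β + 1) :=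
      Real.rpow_le_rpow_of_exponent_le (by linarith) (by linarith)
    have h3 := (convexOn_rpow (p := β + 1) (by linarith)).2 (show (1:ℝ) ∈ Ici 0 by simp)
      (show (2:ℝ) ∈ Ici 0 by simp) (show 0 ≤ 1 - s by linarith) h0 (by ring)
    simp only [smul_eq_mul, Real.one_rpow] at h3
    rw [show (1 - s) * 1 + s * 2 = 1 + s by ring] at h3
    nlinarith
  have hB : 1 - (β + 1) * s ≤ (1 - s) ^ β := by
    rcases eq_or_lt_of_le h1 with h | h
    · have : 0 ≤ (1 - s) ^ β := Real.rpow_nonneg (by linarith) _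
      subst h; linarith
    have h2 : (1 - s) ^ (β + 1) ≤ (1 - s) ^ β :=
      Real.rpow_le_rpow_of_exponent_ge (by linarith) (by linarith) (by linarith)
    have h3 := one_add_mul_self_le_rpow_one_add (s := -s) (by linarith) (p := β + 1) (by linarith)
    rw [show 1 + -s = 1 - s by ring] at h3
    linarith
  have hC : (1 - s) ^ β ≤ (1 + s) ^ β := Real.rpow_le_rpow (by linarith) (by linarith) hβ
  rw [abs_of_nonneg (by linarith)]
  linarith

lemma fd_ptwise2 {β w t : ℝ} (hβ : 0 ≤ β) (hw : 1 ≤ w) (h0 : 0 ≤ t) (h1 : t ≤ w) :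
    |(w + t) ^ β - (w - t) ^ β| ≤ (2 ^ (β + 1) + β + 1) * w ^ (β - 1) * t := by
  have hw0 : 0 < w := by linarith
  have h := fd_ptwise hβ (s := t / w) (by positivity) ((div_le_one hw0).2 h1)
  have e1 : w + t = w * (1 + t / w) := by field_simp
  have e2 : w - t = w * (1 - t / w) := by field_simp
  have h4 : t / w ≤ 1 := (div_le_one hw0).2 h1
  rw [e1, e2, Real.mul_rpow hw0.le (by positivity), Real.mul_rpow hw0.le (by linarith),
    ← mul_sub, abs_mul, abs_of_nonneg (Real.rpow_nonneg hw0.le _), Real.rpow_sub_one hw0.ne']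
  calc _ ≤ w ^ β * ((2 ^ (β + 1) + β + 1) * (t / w)) := by gcongr
    _ = _ := by ring

lemma fd_tail {β w t : ℝ} (hβ : 0 ≤ β) (hw : 1 ≤ w) (h1 : w ≤ t) :
    (w + t) ^ β ≤ 2 ^ β * w ^ (β - 1) * t ^ (β + 1) := by
  have hw0 : 0 < w := by linarith
  have ht0 : 0 < t := by linarith
  have a1 : (w + t) ^ β ≤ (2 * t) ^ β := Real.rpow_le_rpow (by linarith) (by linarith) hβ
  rw [Real.mul_rpow (by norm_num) ht0.le] at a1
  have a2 : 1 ≤ w ^ (β - 1) * t := by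
    calc (1:ℝ) ≤ w ^ β := Real.one_le_rpow hw hβ
      _ = w ^ (β - 1) * w := by rw [Real.rpow_sub_one hw0.ne']; field_simp
      _ ≤ _ := by gcongr
  rw [Real.rpow_add_one ht0.ne']
  calc _ ≤ 2 ^ β * t ^ β * 1 := by linarith
    _ ≤ 2 ^ β * t ^ β * (w ^ (β - 1) * t) := by gcongr
    _ = _ := by ring

lemma fd_formula {β w : ℝ} (hβ : 0 ≤ β) (hw : 1 ≤ w) :
    fermi β w - w ^ (β + 1) / (β + 1) =
      ∫ t in Ioi (0:ℝ), ((w + t) ^ β / (1 + Real.exp t)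
        - (Iic w).indicator (fun t => (w - t) ^ β / (1 + Real.exp t)) t) ∧
    IntegrableOn (fun t : ℝ => (w + t) ^ β / (1 + Real.exp t)) (Ioi 0) := by
  have hw0 : 0 < w := by linarith
  have hF := fd_int hβ w
  have hFw : IntegrableOn (fun x : ℝ => x ^ β / (1 + Real.exp (x - w))) (Ioi w) :=
    hF.mono_set (Ioi_subset_Ioi hw0.le)
  have hsplit : fermi β w = (∫ x in (0:ℝ)..w, x ^ β / (1 + Real.exp (x - w))) +
      ∫ x in Ioi w, x ^ β / (1 + Real.exp (x - w)) := by
    unfold fermi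
    rw [intervalIntegral.integral_of_le hw0.le, ← setIntegral_union (Ioc_disjoint_Ioi le_rfl)
      measurableSet_Ioi (hF.mono_set Ioc_subset_Ioi_self) hFw, Ioc_union_Ioi_eq_Ioi hw0.le]
  have hmp : MeasurePreserving (fun t : ℝ => w + t) volume volume :=
    measurePreserving_add_left volume w
  have hemb : MeasurableEmbedding (fun t : ℝ => w + t) := measurableEmbedding_addLeft w
  have hpre : (fun t : ℝ => w + t) ⁻¹' (Ioi w) = Ioi 0 := by
    ext t; simp
  have hsh : IntegrableOn (fun t : ℝ => (w + t) ^ β / (1 + Real.exp t)) (Ioi 0) := by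
    have := (hmp.integrableOn_comp_preimage hemb).2 hFw
    rw [hpre] at this
    simpa [Function.comp_def] using this
  have hIoi : (∫ x in Ioi w, x ^ β / (1 + Real.exp (x - w))) =
      ∫ t in Ioi (0:ℝ), (w + t) ^ β / (1 + Real.exp t) := by
    have := hmp.setIntegral_preimage_emb hemb
      (fun x : ℝ => x ^ β / (1 + Real.exp (x - w))) (Ioi w)
    rw [hpre] at this
    simpa using this.symm
  have hc1 : Continuous (fun t : ℝ => (w - t) ^ β) :=
    Continuous.rpow_const (by fun_prop) (fun _ => Or.inr hβ)
  have hc2 : Continuous (fun t : ℝ => (w - t) ^ β / (1 + Real.exp t)) :=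
    hc1.div (by fun_prop) (fun t => by positivity)
  have hfin : (∫ x in (0:ℝ)..w, x ^ β / (1 + Real.exp (x - w))) =
      w ^ (β + 1) / (β + 1) - ∫ t in (0:ℝ)..w, (w - t) ^ β / (1 + Real.exp t) := by
    have e := intervalIntegral.integral_comp_sub_left (a := 0) (b := w)
      (fun x : ℝ => x ^ β / (1 + Real.exp (x - w))) w
    have e2 := intervalIntegral.integral_comp_sub_left (a := 0) (b := w)
      (fun x : ℝ => x ^ β) w
    simp only [sub_self, sub_zero] at e e2
    rw [integral_rpow (Or.inl (by linarith)), Real.zero_rpow (by linarith), sub_zero] at e2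
    rw [← e, ← e2, ← intervalIntegral.integral_sub (hc1.intervalIntegrable _ _)
      (hc2.intervalIntegrable _ _)]
    refine intervalIntegral.integral_congr (fun t _ => ?_)
    beta_reduce
    rw [show w - t - w = -t by ring, Real.exp_neg]
    have := Real.exp_pos t
    field_simp
    ring
  have hind : (∫ t in (0:ℝ)..w, (w - t) ^ β / (1 + Real.exp t)) =
      ∫ t in Ioi (0:ℝ), (Iic w).indicator (fun t => (w - t) ^ β / (1 + Real.exp t)) t := by
    rw [intervalIntegral.integral_of_le hw0.le, setIntegral_indicator measurableSet_Iic,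
      Ioi_inter_Iic]
  have hindI : IntegrableOn
      ((Iic w).indicator (fun t => (w - t) ^ β / (1 + Real.exp t))) (Ioi 0) := by
    rw [IntegrableOn, integrable_indicator_iff measurableSet_Iic, IntegrableOn,
      Measure.restrict_restrict measurableSet_Iic, Iic_inter_Ioi]
    exact (hc2.integrableOn_Icc (a := 0) (b := w)).mono_set Ioc_subset_Icc_self
  refine ⟨?_, hsh⟩
  rw [hsplit, hfin, hIoi, hind, integral_sub hsh hindI]
  ring

lemma fd_sommerfeld {β : ℝ} (hβ : 0 ≤ β) : ∃ C > (0:ℝ), ∀ w ≥ (1:ℝ),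
    |fermi β w - w ^ (β + 1) / (β + 1)| ≤ C * w ^ (β - 1) := by
  set K : ℝ := 2 ^ (β + 1) + β + 1 with hK
  have h2 : (0:ℝ) < 2 ^ (β + 1) := by positivity
  have hKp : 0 < K := by linarith
  set G : ℝ → ℝ := fun t => t ^ (1:ℝ) * Real.exp (-t) + t ^ (β + 1) * Real.exp (-t) with hG
  have hGi : IntegrableOn G (Ioi 0) :=
    (fd_expint (by norm_num)).add (fd_expint (by linarith))
  refine ⟨K * |∫ t in Ioi (0:ℝ), G t| + 1, by positivity, fun w hw => ?_⟩
  have hw0 : 0 < w := by linarith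
  have hwp : 0 < w ^ (β - 1) := by positivity
  obtain ⟨e, -⟩ := fd_formula hβ hw
  rw [e]
  have hb : ‖∫ t in Ioi (0:ℝ), ((w + t) ^ β / (1 + Real.exp t)
        - (Iic w).indicator (fun t => (w - t) ^ β / (1 + Real.exp t)) t)‖ ≤
        ∫ t in Ioi (0:ℝ), K * w ^ (β - 1) * G t := by
    refine norm_integral_le_of_norm_le (hGi.const_mul _) ?_
    filter_upwards [ae_restrict_mem measurableSet_Ioi] with t ht
    have ht0 : 0 < t := ht
    have hexp : 1 / (1 + Real.exp t) ≤ Real.exp (-t) := by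
      rw [Real.exp_neg, ← one_div]
      exact one_div_le_one_div_of_le (Real.exp_pos t) (by linarith)
    have hinv : 0 < 1 / (1 + Real.exp t) := by positivity
    have key : ‖(w + t) ^ β / (1 + Real.exp t)
        - (Iic w).indicator (fun t => (w - t) ^ β / (1 + Real.exp t)) t‖ ≤
        (K * w ^ (β - 1) * (t + t ^ (β + 1))) * (1 / (1 + Real.exp t)) := by
      have hp : 0 < t ^ (β + 1) := by positivity
      by_cases h : t ≤ w
      · rw [indicator_of_mem (show t ∈ Iic w from h), ← sub_div, div_eq_mul_one_div, norm_mul,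
          Real.norm_of_nonneg hinv.le]
        refine mul_le_mul_of_nonneg_right ?_ hinv.le
        refine (fd_ptwise2 hβ hw ht0.le h).trans ?_
        have : 0 ≤ K * w ^ (β - 1) * t ^ (β + 1) := by positivity
        rw [← hK]; linarith
      · rw [indicator_of_notMem (show t ∉ Iic w from h), sub_zero, div_eq_mul_one_div, norm_mul,
          Real.norm_of_nonneg hinv.le]
        refine mul_le_mul_of_nonneg_right ?_ hinv.le
        rw [Real.norm_of_nonneg (by positivity)]
        refine (fd_tail hβ hw (le_of_not_ge h)).trans ?_
        have : (2:ℝ) ^ β ≤ K := by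
          have := Real.rpow_le_rpow_of_exponent_le (x := 2) (by norm_num)
            (show β ≤ β + 1 by linarith)
          linarith
        calc _ ≤ K * w ^ (β - 1) * t ^ (β + 1) := by gcongr
          _ ≤ _ := by gcongr; linarith
    refine key.trans ?_
    have hp : 0 < t ^ (β + 1) := by positivity
    calc _ ≤ (K * w ^ (β - 1) * (t + t ^ (β + 1))) * Real.exp (-t) := by gcongr
      _ = _ := by simp only [hG, Real.rpow_one]; ring
  rw [integral_const_mul] at hb
  rw [Real.norm_eq_abs] at hb
  refine hb.trans ?_
  have := le_abs_self (∫ t in Ioi (0:ℝ), G t)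
  calc _ ≤ K * w ^ (β - 1) * |∫ t in Ioi (0:ℝ), G t| := by gcongr
    _ ≤ _ := by nlinarith

lemma fd_pow_lip {p K A B : ℝ} (hp : 1 ≤ p) (hA : 0 ≤ A) (hB : 0 ≤ B) (hAK : A ≤ K)
    (hBK : B ≤ K) : |A ^ p - B ^ p| ≤ p * K ^ (p - 1) * |A - B| := by
  have := (convex_Icc (0:ℝ) K).norm_image_sub_le_of_norm_hasDerivWithin_le
    (f := fun x => x ^ p) (f' := fun x => p * x ^ (p - 1)) (C := p * K ^ (p - 1))
    (fun x _ => (Real.hasDerivAt_rpow_const (Or.inr hp)).hasDerivWithinAt)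
    (fun x hx => by
      have : 0 ≤ x ^ (p - 1) := Real.rpow_nonneg hx.1 _
      rw [Real.norm_of_nonneg (by positivity)]
      have := Real.rpow_le_rpow hx.1 hx.2 (show 0 ≤ p - 1 by linarith)
      gcongr) (x := B) (y := A) ⟨hB, hBK⟩ ⟨hA, hAK⟩
  simpa using this

/-- Inversion of the density: for large `y`, `w = f_{a-1}⁻¹(y)` is large and asymptotically
controlled. -/
lemma fd_inv {a : ℝ} (ha : 1 ≤ a) : ∃ C > (0:ℝ), ∃ y₀ > (0:ℝ), ∀ y ≥ y₀,
    1 ≤ invFun (fermi (a - 1)) y ∧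
    |a * y - (invFun (fermi (a - 1)) y) ^ a| ≤ C * (invFun (fermi (a - 1)) y) ^ (a - 2) ∧
    a * y ≤ 2 * (invFun (fermi (a - 1)) y) ^ a ∧
    (invFun (fermi (a - 1)) y) ^ a ≤ 2 * (a * y) := by
  have hβ : 0 ≤ a - 1 := by linarith
  have ha0 : 0 < a := by linarith
  obtain ⟨C, hC, h⟩ := fd_sommerfeld hβ
  have h' : ∀ w ≥ (1:ℝ), |a * fermi (a - 1) w - w ^ a| ≤ a * C * w ^ (a - 2) := by
    intro w hw
    have := h w hw
    rw [show a - 1 + 1 = a by ring, show a - 1 - 1 = a - 2 by ring] at this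
    have e : a * fermi (a - 1) w - w ^ a = a * (fermi (a - 1) w - w ^ a / a) := by field_simp
    rw [e, abs_mul, abs_of_pos ha0, mul_assoc]
    gcongr
  set M : ℝ := 1 + 2 * (a * C) with hM
  have hCp : 0 < a * C := by positivity
  have hM1 : 1 ≤ M := by linarith
  have h2 : ∀ w ≥ M, |a * fermi (a - 1) w - w ^ a| ≤ w ^ a / 2 := by
    intro w hw
    have hw1 : 1 ≤ w := by linarith
    have hw0 : 0 < w := by linarith
    refine (h' w hw1).trans ?_
    have e : w ^ a = w ^ (a - 2) * w ^ 2 := by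
      rw [← Real.rpow_natCast w 2, ← Real.rpow_add hw0]; norm_num
    have : 0 < w ^ (a - 2) := by positivity
    rw [e]
    have : a * C ≤ w ^ 2 / 2 := by nlinarith
    nlinarith
  have hsurj : ∀ y ≥ fermi (a - 1) M, ∃ w, fermi (a - 1) w = y := by
    intro y hy
    obtain ⟨w2, hw2⟩ : ∃ w2, y ≤ fermi (a - 1) w2 := by
      set v := max M ((2 * (a * |y|)) ^ (1 / a)) with hv
      refine ⟨v, ?_⟩
      have b := (abs_le.1 (h2 v (le_max_left _ _))).1
      have c : 2 * (a * |y|) ≤ v ^ a := by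
        have := Real.rpow_le_rpow (by positivity)
          (le_max_right M ((2 * (a * |y|)) ^ (1 / a))) ha0.le
        rwa [← Real.rpow_mul (by positivity), one_div_mul_cancel ha0.ne', Real.rpow_one] at this
      have d : a * |y| ≤ a * fermi (a - 1) v := by linarith
      exact (le_abs_self y).trans (le_of_mul_le_mul_left d ha0)
    exact mem_range_of_exists_le_of_exists_ge (fd_cont hβ) ⟨M, hy⟩ ⟨w2, hw2⟩
  refine ⟨a * C, hCp, |fermi (a - 1) M| + 1, by positivity, fun y hy => ?_⟩
  have hyM : fermi (a - 1) M < y := by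
    have := le_abs_self (fermi (a - 1) M); linarith
  have hinv : fermi (a - 1) (invFun (fermi (a - 1)) y) = y := invFun_eq (hsurj y hyM.le)
  set w := invFun (fermi (a - 1)) y
  have hwM : M ≤ w := by
    by_contra hlt
    have := fd_mono hβ (le_of_not_ge hlt)
    linarith
  have hw1 : 1 ≤ w := by linarith
  have q1 := h' w hw1
  have q2 := abs_le.1 (h2 w hwM)
  rw [hinv] at q1 q2
  have : 0 < w ^ a := by positivity
  exact ⟨hw1, q1, by linarith [q2.2], by linarith [q2.1]⟩

theorem fermiDiracPressure_asymptotics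
    (d : ℕ) (hd : 2 ≤ d) (μ : ℝ) (hμ : 0 < μ) :
    ∃ C > (0:ℝ), ∃ z₀ > (0:ℝ), ∀ z ≥ z₀,
      |fermiDiracPressure d μ z -
        (2 / ((d : ℝ) + 2)) * ((d : ℝ) / μ) ^ (2 / (d : ℝ)) * z ^ (1 + 2 / (d : ℝ))| ≤
      C * z ^ (1 - 2 / (d : ℝ)) := by
  have hd2 : (2:ℝ) ≤ d := by exact_mod_cast hd
  have hd0 : (0:ℝ) < d := by linarith
  obtain ⟨a, hda⟩ : ∃ a : ℝ, a = (d:ℝ) / 2 := ⟨_, rfl⟩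
  have hdd : (d:ℝ) = 2 * a := by linarith
  have ha : 1 ≤ a := by linarith
  have ha0 : 0 < a := by linarith
  obtain ⟨C₁, hC₁, y₀, hy₀, H⟩ := fd_inv ha
  obtain ⟨C₂, hC₂, S⟩ := fd_sommerfeld (β := a) (by linarith)
  set D : ℝ := C₂ + (1 + 1 / a) * 2 ^ (1 / a) * C₁ with hD
  have hDp : 0 < D := by positivity
  refine ⟨μ / d * D * (2 * (d / μ)) ^ (1 - 2 / (d:ℝ)), by positivity, μ / 2 * y₀,
    by positivity, fun z hz => ?_⟩
  have hz0 : 0 < z := lt_of_lt_of_le (by positivity) hz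
  obtain ⟨hw1, i1, i2, i3⟩ := H (2 * z / μ) (by
    rw [ge_iff_le, le_div_iff₀ hμ]; linarith)
  unfold fermiDiracPressure
  rw [← hda]
  set w := invFun (fermi (a - 1)) (2 * z / μ)
  have hw0 : 0 < w := by linarith
  have hY : a * (2 * z / μ) = d / μ * z := by rw [hdd]; ring
  rw [hY] at i1 i2 i3
  set Y : ℝ := d / μ * z with hYdef
  have hYp : 0 < Y := by positivity
  have h1a : 2 / (d:ℝ) = 1 / a := by rw [hdd]; field_simp
  have main : (2 / ((d : ℝ) + 2)) * ((d : ℝ) / μ) ^ (2 / (d : ℝ)) * z ^ (1 + 2 / (d : ℝ))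
      = μ / d * (Y ^ (1 + 1 / a) / (a + 1)) := by
    rw [hYdef, Real.mul_rpow (by positivity) hz0.le, h1a,
      Real.rpow_add (show 0 < (d:ℝ) / μ by positivity), Real.rpow_one, hdd]
    field_simp
  rw [main, ← mul_sub, abs_mul, abs_of_pos (show 0 < μ / d by positivity)]
  have hwa : 0 < w ^ a := by positivity
  have L := fd_pow_lip (p := 1 + 1 / a) (K := 2 * w ^ a) (A := w ^ a) (B := Y)
    (by have : 0 < 1 / a := by positivity
        linarith) hwa.le hYp.le (by linarith) i2
  have e1 : (w ^ a) ^ (1 + 1 / a) = w ^ (a + 1) := by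
    rw [← Real.rpow_mul hw0.le]; congr 1; field_simp
  have e2 : (2 * w ^ a) ^ (1 + 1 / a - 1) = 2 ^ (1 / a) * w := by
    rw [show 1 + 1 / a - 1 = 1 / a by ring, Real.mul_rpow (by norm_num) hwa.le,
      ← Real.rpow_mul hw0.le, mul_one_div_cancel ha0.ne', Real.rpow_one]
  rw [e1, e2] at L
  have e3 : w * w ^ (a - 2) = w ^ (a - 1) := by
    rw [mul_comm, ← Real.rpow_add_one hw0.ne']; congr 1; ring
  have hwm : 0 < w ^ (a - 1) := by positivity
  have L2 : |w ^ (a + 1) - Y ^ (1 + 1 / a)| ≤ (1 + 1 / a) * 2 ^ (1 / a) * C₁ * w ^ (a - 1) := by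
    rw [abs_sub_comm Y] at i1
    calc _ ≤ (1 + 1 / a) * (2 ^ (1 / a) * w) * (C₁ * w ^ (a - 2)) := by
          refine L.trans ?_; gcongr
      _ = (1 + 1 / a) * 2 ^ (1 / a) * C₁ * (w * w ^ (a - 2)) := by ring
      _ = _ := by rw [e3]
  have L3 : |fermi a w - Y ^ (1 + 1 / a) / (a + 1)| ≤ D * w ^ (a - 1) := by
    have s := S w hw1
    have t : |w ^ (a + 1) / (a + 1) - Y ^ (1 + 1 / a) / (a + 1)| ≤
        (1 + 1 / a) * 2 ^ (1 / a) * C₁ * w ^ (a - 1) := by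
      rw [← sub_div, abs_div, abs_of_pos (show 0 < a + 1 by linarith)]
      exact (div_le_self (abs_nonneg _) (by linarith)).trans L2
    have := abs_sub_le (fermi a w) (w ^ (a + 1) / (a + 1)) (Y ^ (1 + 1 / a) / (a + 1))
    rw [hD]; linarith
  have L4 : w ^ (a - 1) ≤ (2 * (d / μ)) ^ (1 - 2 / (d:ℝ)) * z ^ (1 - 2 / (d:ℝ)) := by
    have hexp : 0 ≤ 1 - 2 / (d:ℝ) := by
      rw [sub_nonneg, div_le_one hd0]; exact hd2
    rw [← Real.mul_rpow (by positivity) hz0.le]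
    have := Real.rpow_le_rpow hwa.le i3 hexp
    rw [← Real.rpow_mul hw0.le] at this
    have e : a * (1 - 2 / (d:ℝ)) = a - 1 := by rw [h1a]; field_simp
    rw [e] at this
    rwa [mul_assoc, ← hYdef]
  calc _ ≤ μ / d * (D * ((2 * (d / μ)) ^ (1 - 2 / (d:ℝ)) * z ^ (1 - 2 / (d:ℝ)))) := by
        have := L3.trans (mul_le_mul_of_nonneg_left L4 hDp.le)
        gcongr
    _ = _ := by ring
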